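/- Let ω := exp(2πi/3), Λ := {(4/3)·π·i·ω·(a₁ + ω·a₂) : a₁, a₂ ∈ ℤ}, Λ* := {√3·ω·(m + ω·n) : m, n ∈ ℤ}, and ⟨z, w⟩ := (z·conj(w) + conj(z)·w)/2. (i) If 𝐤 = p − i with p ∈ Λ*, then w(z) := (exp(−i·⟨z, 𝐤⟩), 0) satisfies (D(0)w)(z) + 𝐤·w(z) = 0 for all z and ℒ_a w = w for every a ∈ Λ. (ii) If 𝐤 ∈ Λ*, then w(z) := (0, exp(−i·⟨z, 𝐤⟩)) satisfies (D(0)w)(z) + 𝐤·w(z) = 0 for all z and ℒ_a w = w for every a ∈ Λ. -/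

import Mathlib

/-- `ω = exp(2πi/3)`. -/
noncomputable def ω : ℂ := Complex.exp (2 * Real.pi * Complex.I / 3)

/-- The tunneling potential `U(z) = Σ_{k=0}^{2} ω^k exp((z ω̄^k − z̄ ω^k)/2)`. -/
noncomputable def U (z : ℂ) : ℂ :=
  ∑ k ∈ Finset.range 3,
    ω ^ k * Complex.exp ((z * (starRingEnd ℂ ω) ^ k - (starRingEnd ℂ z) * ω ^ k) / 2)

/-- The real pairing `⟨z,w⟩ = (z w̄ + z̄ w)/2 = Re(z w̄)` (valued in `ℂ`). -/
noncomputable def pairing (z w : ℂ) : ℂ :=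
  (z * starRingEnd ℂ w + starRingEnd ℂ z * w) / 2

/-- `(2 D_{z̄} f)(z) = −i (∂₁ f(z) + i ∂₂ f(z))`. -/
noncomputable def Dzbar (f : ℂ → ℂ) (z : ℂ) : ℂ :=
  -Complex.I * (fderiv ℝ f z 1 + Complex.I * fderiv ℝ f z Complex.I)

/-- The chiral TBG operator `D(α)`; `D(0)` acts componentwise as `2D_{z̄}`. -/
noncomputable def Dop (α : ℂ) (u : ℂ → ℂ × ℂ) (z : ℂ) : ℂ × ℂ :=
  (Dzbar (fun w => (u w).1) z + α * U z * (u z).2,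
   α * U (-z) * (u z).1 + Dzbar (fun w => (u w).2) z)

/-- The lattice vector `a = (4/3)πiω(a₁ + ω a₂)`. -/
noncomputable def latVec (a₁ a₂ : ℤ) : ℂ :=
  (4 / 3) * (Real.pi : ℂ) * Complex.I * ω * ((a₁ : ℂ) + ω * (a₂ : ℂ))

/-- The twisted translation `(ℒ_a u)(z) = (ω^{a₁+a₂} u₁(z+a), u₂(z+a))`. -/
noncomputable def Ltrans (a₁ a₂ : ℤ) (u : ℂ → ℂ × ℂ) (z : ℂ) : ℂ × ℂ :=
  (ω ^ (a₁ + a₂) * (u (z + latVec a₁ a₂)).1, (u (z + latVec a₁ a₂)).2)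

/-- The zero mode `w(z) = (exp(−i⟨z,𝐤⟩), 0)` used at the Dirac point `K'`. -/
noncomputable def wTop (k : ℂ) (z : ℂ) : ℂ × ℂ :=
  (Complex.exp (-Complex.I * pairing z k), 0)

/-- The zero mode `w(z) = (0, exp(−i⟨z,𝐤⟩))` used at the Dirac point `K`. -/
noncomputable def wBot (k : ℂ) (z : ℂ) : ℂ × ℂ :=
  (0, Complex.exp (-Complex.I * pairing z k))

lemma om_eq : ω = -1/2 + (Real.sqrt 3 : ℂ) / 2 * Complex.I := by
  have h1 : (2 * Real.pi * Complex.I / 3 : ℂ) = ((Real.pi - Real.pi / 3 : ℝ) : ℂ) * Complex.I := by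
    push_cast; ring
  unfold ω
  rw [h1, Complex.exp_mul_I, ← Complex.ofReal_cos, ← Complex.ofReal_sin, Real.cos_pi_sub,
    Real.sin_pi_sub, Real.cos_pi_div_three, Real.sin_pi_div_three]
  push_cast; ring

lemma om_conj : starRingEnd ℂ ω = -1/2 - (Real.sqrt 3 : ℂ) / 2 * Complex.I := by
  rw [om_eq]
  simp only [map_add, map_mul, map_div₀, map_neg, map_one, Complex.conj_ofReal, Complex.conj_I,
    map_ofNat]
  ring

lemma sq3 : (Real.sqrt 3 : ℂ) ^ 2 = 3 := by
  rw [← Complex.ofReal_pow, Real.sq_sqrt (by norm_num)]; norm_num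

lemma pairing_add (z w k : ℂ) : pairing (z + w) k = pairing z k + pairing w k := by
  simp only [pairing, map_add]; ring

lemma pairing_lat (a b m n : ℤ) :
    pairing (latVec a b) ((Real.sqrt 3 : ℂ) * ω * ((m : ℂ) + ω * (n : ℂ)))
      = 2 * Real.pi * ((a * n - b * m : ℤ) : ℂ) := by
  simp only [pairing, latVec, map_add, map_mul, map_div₀, Complex.conj_ofReal, Complex.conj_I,
    map_ofNat, map_intCast, om_conj]
  rw [om_eq]
  have h := sq3
  have hI := Complex.I_sq
  generalize (Real.sqrt 3 : ℂ) = s at *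
  generalize (Real.pi : ℂ) = q at *
  generalize Complex.I = i at *
  push_cast
  have e4 : s ^ 4 = 9 := by linear_combination (s^2+3) * h
  have i4 : i ^ 4 = 1 := by linear_combination (i^2-1) * hI
  grind

lemma pairing_lat_I (a b : ℤ) :
    pairing (latVec a b) (-Complex.I) = 2 * Real.pi / 3 * ((a + b : ℤ) : ℂ) := by
  simp only [pairing, latVec, map_add, map_mul, map_div₀, Complex.conj_ofReal, Complex.conj_I,
    map_ofNat, map_intCast, om_conj, map_neg]
  rw [om_eq]
  have h := sq3
  have hI := Complex.I_sq
  generalize (Real.sqrt 3 : ℂ) = s at *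
  generalize (Real.pi : ℂ) = q at *
  generalize Complex.I = i at *
  push_cast
  grind

lemma Dzbar_exp (k z : ℂ) :
    Dzbar (fun w => Complex.exp (-Complex.I * pairing w k)) z
      = -k * Complex.exp (-Complex.I * pairing z k) := by
  let L : ℂ →L[ℝ] ℂ := ((-Complex.I * starRingEnd ℂ k / 2) • ContinuousLinearMap.id ℝ ℂ)
    + (-Complex.I * k / 2) • (Complex.conjCLE : ℂ →L[ℝ] ℂ)
  have hL : ∀ w, L w = -Complex.I * pairing w k := by
    intro w
    simp [L, pairing]
    ring
  have hd : HasFDerivAt (fun w => Complex.exp (-Complex.I * pairing w k))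
      (Complex.exp (L z) • L) z := by
    have := (L.hasFDerivAt (x := z)).cexp
    simpa only [hL] using this
  unfold Dzbar
  rw [hd.fderiv]
  simp only [ContinuousLinearMap.smul_apply, hL, pairing, smul_eq_mul, map_one, Complex.conj_I]
  have hI := Complex.I_sq
  generalize Complex.exp _ = e
  generalize starRingEnd ℂ k = c
  generalize Complex.I = i at *
  grind

lemma Dzbar_zero (z : ℂ) : Dzbar (fun _ => (0 : ℂ)) z = 0 := by
  simp [Dzbar]

lemma exp_lat (a b m n : ℤ) (p : ℂ)
    (hp : p = (Real.sqrt 3 : ℂ) * ω * ((m : ℂ) + ω * (n : ℂ))) :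
    Complex.exp (-Complex.I * pairing (latVec a b) p) = 1 := by
  rw [hp, pairing_lat, Complex.exp_eq_one_iff]
  exact ⟨-(a * n - b * m), by push_cast; ring⟩

lemma pairing_add_right (z k l : ℂ) : pairing z (k + l) = pairing z k + pairing z l := by
  simp only [pairing, map_add]; ring

lemma exp_lat_I (a b : ℤ) :
    ω ^ (a + b) * Complex.exp (-Complex.I * pairing (latVec a b) (-Complex.I)) = 1 := by
  rw [pairing_lat_I, ω, ← Complex.exp_int_mul, ← Complex.exp_add, ← Complex.exp_zero]
  congr 1
  ring

/-- Zero modes of the decoupled Hamiltonian `D(0)` at the Dirac points: for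
`p ∈ Λ* = √3 ω (ℤ ⊕ ωℤ)`, the function `(exp(−i⟨z, p−i⟩), 0)` is an `ℒ`-invariant
solution of `(D(0) + (p−i))w = 0`, and `(0, exp(−i⟨z, p⟩))` is an `ℒ`-invariant
solution of `(D(0) + p)w = 0`. -/
theorem decoupled_zero_modes (p : ℂ)
    (hp : ∃ m n : ℤ, p = (Real.sqrt 3 : ℂ) * ω * ((m : ℂ) + ω * (n : ℂ))) :
    ((∀ z : ℂ, Dop 0 (wTop (p - Complex.I)) z + (p - Complex.I) • wTop (p - Complex.I) z = 0) ∧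
      ∀ a₁ a₂ : ℤ, ∀ z : ℂ, Ltrans a₁ a₂ (wTop (p - Complex.I)) z = wTop (p - Complex.I) z) ∧
    ((∀ z : ℂ, Dop 0 (wBot p) z + p • wBot p z = 0) ∧
      ∀ a₁ a₂ : ℤ, ∀ z : ℂ, Ltrans a₁ a₂ (wBot p) z = wBot p z) := by
  obtain ⟨m, n, hp⟩ := hp
  refine ⟨⟨fun z => ?_, fun a b z => ?_⟩, ⟨fun z => ?_, fun a b z => ?_⟩⟩
  · simp only [Dop, wTop, Dzbar_exp, Dzbar_zero]
    ext
    · simp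
      ring
    · simp
  · simp only [Ltrans, wTop]
    rw [pairing_add, mul_add, Complex.exp_add]
    have h1 := exp_lat a b m n p hp
    have h2 := exp_lat_I a b
    rw [sub_eq_add_neg, pairing_add_right (latVec a b), mul_add, Complex.exp_add, h1]
    ext
    · simp only
      linear_combination Complex.exp (-Complex.I * pairing z (p + -Complex.I)) * h2
    · rfl
  · simp only [Dop, wBot, Dzbar_exp, Dzbar_zero]
    ext <;> simp
  · simp only [Ltrans, wBot]
    rw [pairing_add, mul_add, Complex.exp_add, exp_lat a b m n p hp]
    simp
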